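/- arXiv:2510.13583 — 4 statements merged into one kernel-verified Lean document; each statement's English description precedes it below -/
import Mathlib

section
/- Let d ≥ 1 and let Ω₁, Ω₂, Ω̂₁, Ω̂₂ be invertible diagonal d×d real matrices, and let M be an invertible d×d real matrix satisfying Mᵀ * Ω₁ * M = Ω̂₁ and Mᵀ * Ω₂ * M = Ω̂₂. Assume the diagonal entries of Ω₁⁻¹ * Ω₂ are pairwise distinct, i.e. (Ω₁⁻¹ * Ω₂) i i ≠ (Ω₁⁻¹ * Ω₂) j j for all i ≠ j. Then M is a scaled permutation matrix: there exist a permutation σ of Fin d and scalars c : Fin d → ℝ with c i ≠ 0 for all i, such that M i j = (if i = σ j then c j else 0) for all i, j. -/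
open Matrix

/-- If `M` is invertible and congruences `Mᵀ * Ω₁ * M = Ψ₁`, `Mᵀ * Ω₂ * M = Ψ₂`
hold for invertible diagonal matrices `Ω₁, Ω₂, Ψ₁, Ψ₂` (with `Ψ` playing the role of `Ω̂`),
and the diagonal entries of `Ω₁⁻¹ * Ω₂` are pairwise distinct, then `M` is a scaled
permutation matrix. -/
theorem scaled_permutation_of_double_congruence {d : ℕ} (hd : 1 ≤ d)
    (Ω₁ Ω₂ Ψ₁ Ψ₂ M : Matrix (Fin d) (Fin d) ℝ)
    (hΩ₁diag : Ω₁.IsDiag) (hΩ₂diag : Ω₂.IsDiag) (hΨ₁diag : Ψ₁.IsDiag) (hΨ₂diag : Ψ₂.IsDiag)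
    (hΩ₁ : IsUnit Ω₁) (hΩ₂ : IsUnit Ω₂) (hΨ₁ : IsUnit Ψ₁) (hΨ₂ : IsUnit Ψ₂)
    (hM : IsUnit M)
    (h1 : Mᵀ * Ω₁ * M = Ψ₁) (h2 : Mᵀ * Ω₂ * M = Ψ₂)
    (hdist : ∀ i j : Fin d, i ≠ j → (Ω₁⁻¹ * Ω₂) i i ≠ (Ω₁⁻¹ * Ω₂) j j) :
    ∃ (σ : Equiv.Perm (Fin d)) (c : Fin d → ℝ), (∀ j, c j ≠ 0) ∧
      ∀ i j, M i j = if i = σ j then c j else 0 := by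
  obtain ⟨a, rfl⟩ : ∃ a, Ω₁ = diagonal a := ⟨_, hΩ₁diag.diagonal_diag.symm⟩
  obtain ⟨b, rfl⟩ : ∃ b, Ω₂ = diagonal b := ⟨_, hΩ₂diag.diagonal_diag.symm⟩
  obtain ⟨p, rfl⟩ : ∃ p, Ψ₁ = diagonal p := ⟨_, hΨ₁diag.diagonal_diag.symm⟩
  obtain ⟨q, rfl⟩ : ∃ q, Ψ₂ = diagonal q := ⟨_, hΨ₂diag.diagonal_diag.symm⟩
  have ha : ∀ i, a i ≠ 0 := fun i =>
    ((Pi.isUnit_iff.1 (isUnit_diagonal.1 hΩ₁)) i).ne_zero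
  have hp : ∀ i, p i ≠ 0 := fun i =>
    ((Pi.isUnit_iff.1 (isUnit_diagonal.1 hΨ₁)) i).ne_zero
  have hinv : (diagonal a)⁻¹ = diagonal (fun i => (a i)⁻¹) := by
    apply inv_eq_left_inv
    rw [diagonal_mul_diagonal, ← diagonal_one]
    congr 1
    funext i
    exact inv_mul_cancel₀ (ha i)
  have hd' : ∀ i j, (a i)⁻¹ * b i = (a j)⁻¹ * b j → i = j := by
    intro i j h
    by_contra hij
    apply hdist i j hij
    rw [hinv, diagonal_mul_diagonal]
    simpa using h
  have hMt : IsUnit Mᵀ := (isUnit_transpose M).2 hM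
  have hkey : diagonal b * M = diagonal a * M * diagonal (fun j => (p j)⁻¹ * q j) := by
    apply hMt.mul_left_cancel
    have h3 : Mᵀ * (diagonal a * M * diagonal (fun j => (p j)⁻¹ * q j))
        = (Mᵀ * diagonal a * M) * diagonal (fun j => (p j)⁻¹ * q j) := by
      simp only [Matrix.mul_assoc]
    rw [h3, h1, ← Matrix.mul_assoc, h2, diagonal_mul_diagonal]
    congr 1
    funext i
    rw [mul_inv_cancel_left₀ (hp i)]
  have hent : ∀ i j, M i j ≠ 0 → (a i)⁻¹ * b i = (p j)⁻¹ * q j := by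
    intro i j hij
    have h := congrFun (congrFun hkey i) j
    rw [mul_diagonal, diagonal_mul, diagonal_mul] at h
    have h4 : b i = a i * ((p j)⁻¹ * q j) := by
      apply mul_right_cancel₀ hij
      rw [h]; ring
    rw [h4, inv_mul_cancel_left₀ (ha i)]
  have hdet : M.det ≠ 0 := ((isUnit_iff_isUnit_det M).1 hM).ne_zero
  have hcol : ∀ j, ∃ i, M i j ≠ 0 := by
    intro j
    by_contra! h
    exact hdet (det_eq_zero_of_column_eq_zero j h)
  have hrow : ∀ i, ∃ j, M i j ≠ 0 := by
    intro i
    by_contra! h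
    exact hdet (det_eq_zero_of_row_eq_zero i h)
  choose s hs using hcol
  have huniq : ∀ i j, M i j ≠ 0 → i = s j := fun i j h =>
    hd' _ _ ((hent i j h).trans (hent _ j (hs j)).symm)
  have hsurj : Function.Surjective s := by
    intro i
    obtain ⟨j, hj⟩ := hrow i
    exact ⟨j, (huniq i j hj).symm⟩
  refine ⟨Equiv.ofBijective s (Finite.surjective_iff_bijective.1 hsurj),
    fun j => M (s j) j, hs, ?_⟩
  intro i j
  rw [Equiv.ofBijective_apply]
  split_ifs with h
  · rw [h]
  · by_contra h'
    exact h (huniq i j h')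
end

section
/- Let k ≥ 1 environments be indexed by Fin k, let d ≥ 1, let μ : Fin d → ℝ, v : Fin d → ℝ with v j > 0 for all j, and λ : Fin k → Fin d → ℝ with λ i j ≠ 0 for all i, j. Assume the sufficient-variability condition: for every j, ∑ i, (λ i j)⁻² ≠ k. Then for s : Fin d → ℝ, the following are equivalent: (1) for every j, ∑ i, (deriv (fun x => Real.log ((Real.sqrt (2 * π * (v j)))⁻¹ * Real.exp (-(x - μ j)^2 / (2 * (v j))))) (s j) - deriv (fun x => Real.log ((Real.sqrt (2 * π * ((λ i j)^2 * v j)))⁻¹ * Real.exp (-(x - μ j)^2 / (2 * ((λ i j)^2 * v j))))) (s j)) = 0; (2) s = μ. -/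
open Real

lemma deriv_log_gauss (m w y : ℝ) (hw : 0 < w) :
    deriv (fun x : ℝ =>
      Real.log ((Real.sqrt (2 * π * w))⁻¹ * Real.exp (-(x - m) ^ 2 / (2 * w)))) y
      = -(y - m) / w := by
  have hc : (Real.sqrt (2 * π * w))⁻¹ ≠ 0 := by
    have : 0 < 2 * π * w := by positivity
    positivity
  have h : (fun x : ℝ =>
      Real.log ((Real.sqrt (2 * π * w))⁻¹ * Real.exp (-(x - m) ^ 2 / (2 * w))))
      = fun x => Real.log ((Real.sqrt (2 * π * w))⁻¹) + (-(x - m) ^ 2 / (2 * w)) := by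
    funext x
    rw [Real.log_mul hc (Real.exp_ne_zero _), Real.log_exp]
  rw [h]
  have h2 := (((((hasDerivAt_id y).sub_const m).pow 2).neg).div_const (2 * w)).const_add
    (Real.log ((Real.sqrt (2 * π * w))⁻¹))
  refine (HasDerivAt.deriv h2).trans ?_
  simp only [id]
  field_simp
  norm_num
  ring

/-- For independent Gaussian sources (means `μ j`, variances `v j`) and `k`
environments rescaling source `j` by `λ i j` (same means), under the sufficient-variability
condition `∑ i, (λ i j)⁻² ≠ k`, the sum over environments of the coordinatewise score
differences vanishes at `s` iff `s = μ`. -/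
theorem score_diff_zero_iff_mean {k d : ℕ} (hk : 1 ≤ k) (hd : 1 ≤ d)
    (μ : Fin d → ℝ) (v : Fin d → ℝ) (hv : ∀ j, 0 < v j)
    (lam : Fin k → Fin d → ℝ) (hlam : ∀ i j, lam i j ≠ 0)
    (hvar : ∀ j, (∑ i, ((lam i j) ^ 2)⁻¹) ≠ (k : ℝ))
    (s : Fin d → ℝ) :
    (∀ j, ∑ i, (deriv (fun x : ℝ =>
          Real.log ((Real.sqrt (2 * π * v j))⁻¹ * Real.exp (-(x - μ j) ^ 2 / (2 * v j)))) (s j)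
        - deriv (fun x : ℝ =>
          Real.log ((Real.sqrt (2 * π * ((lam i j) ^ 2 * v j)))⁻¹ *
            Real.exp (-(x - μ j) ^ 2 / (2 * ((lam i j) ^ 2 * v j))))) (s j)) = 0)
      ↔ s = μ := by
  have key : ∀ j, ∑ i, (deriv (fun x : ℝ =>
          Real.log ((Real.sqrt (2 * π * v j))⁻¹ * Real.exp (-(x - μ j) ^ 2 / (2 * v j)))) (s j)
        - deriv (fun x : ℝ =>
          Real.log ((Real.sqrt (2 * π * ((lam i j) ^ 2 * v j)))⁻¹ *
            Real.exp (-(x - μ j) ^ 2 / (2 * ((lam i j) ^ 2 * v j))))) (s j))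
      = (s j - μ j) / v j * ((∑ i, ((lam i j) ^ 2)⁻¹) - k) := by
    intro j
    have hterm : ∀ i, (deriv (fun x : ℝ =>
          Real.log ((Real.sqrt (2 * π * v j))⁻¹ * Real.exp (-(x - μ j) ^ 2 / (2 * v j)))) (s j)
        - deriv (fun x : ℝ =>
          Real.log ((Real.sqrt (2 * π * ((lam i j) ^ 2 * v j)))⁻¹ *
            Real.exp (-(x - μ j) ^ 2 / (2 * ((lam i j) ^ 2 * v j))))) (s j))
        = (s j - μ j) / v j * (((lam i j) ^ 2)⁻¹ - 1) := by
      intro i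
      have h1 := hv j
      have h2 := hlam i j
      rw [deriv_log_gauss _ _ _ h1, deriv_log_gauss _ _ _ (by positivity)]
      field_simp
      ring
    rw [Finset.sum_congr rfl (fun i _ => hterm i), ← Finset.mul_sum, Finset.sum_sub_distrib]
    simp
  simp only [key]
  constructor
  · intro h
    funext j
    rcases mul_eq_zero.mp (h j) with h1 | h1
    · rcases div_eq_zero_iff.mp h1 with h2 | h2
      · exact sub_eq_zero.mp h2
      · exact absurd h2 (hv j).ne'
    · exact absurd (sub_eq_zero.mp h1) (hvar j)
  · rintro rfl j
    simp
end

section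
/- Let k ≥ 1, d ≥ 2, and let I₁, I₂ be disjoint nonempty subsets (Finsets) of Fin k. For λ : Fin k → Fin d → ℝ define A λ j := (∑ i ∈ I₁, (λ i j)⁻²) - |I₁| and B λ j := (∑ i ∈ I₂, (λ i j)⁻²) - |I₂|, where |I_l| denotes cardinality. Then the set {λ : Fin k → Fin d → ℝ | (∀ i j, λ i j ≠ 0) ∧ ((∃ j, A λ j = 0) ∨ (∃ j, B λ j = 0) ∨ (∃ j ℓ, j ≠ ℓ ∧ A λ j * B λ ℓ = A λ ℓ * B λ j))} has Lebesgue measure zero in Fin k → Fin d → ℝ. -/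
/-- For a group of environments `I ⊆ Fin k` and rescalings `λ`, the quantity
`A_I(λ, j) := (∑ i ∈ I, (λ i j)⁻²) - |I|` appearing in the diagonal entries of the
Hessian-difference matrices. -/
noncomputable def envQuantity {k d : ℕ} (I : Finset (Fin k))
    (lam : Fin k → Fin d → ℝ) (j : Fin d) : ℝ :=
  (∑ i ∈ I, ((lam i j) ^ 2)⁻¹) - (I.card : ℝ)

open MeasureTheory in
lemma measurable_envQuantity_aux {k d : ℕ} (I : Finset (Fin k)) (j : Fin d) :
    Measurable (fun lam : Fin k → Fin d → ℝ => envQuantity I lam j) := by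
  unfold envQuantity
  fun_prop

open MeasureTheory in
/-- The array `t` times the elementary array at `(i, j)`, as a linear map. -/
noncomputable def dirMap {k d : ℕ} (i : Fin k) (j : Fin d) : ℝ →ₗ[ℝ] (Fin k → Fin d → ℝ) :=
  (LinearMap.single ℝ (fun _ : Fin k => Fin d → ℝ) i).comp
    (LinearMap.single ℝ (fun _ : Fin d => ℝ) j)

lemma dirMap_apply {k d : ℕ} (i : Fin k) (j : Fin d) (t : ℝ) (a : Fin k) (b : Fin d) :
    dirMap i j t a b = if a = i ∧ b = j then t else 0 := by
  simp only [dirMap, LinearMap.comp_apply, LinearMap.single_apply, Pi.single_apply]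
  by_cases ha : a = i <;> by_cases hb : b = j <;> simp [ha, hb, Pi.single_apply]

lemma env_dir_col {k d : ℕ} (I : Finset (Fin k)) (i : Fin k) (j l : Fin d) (h : l ≠ j)
    (y : Fin k → Fin d → ℝ) (t : ℝ) :
    envQuantity I (y + dirMap i j t) l = envQuantity I y l := by
  simp [envQuantity, dirMap_apply, h]

lemma env_dir_row {k d : ℕ} (I : Finset (Fin k)) (i : Fin k) (hi : i ∉ I) (j l : Fin d)
    (y : Fin k → Fin d → ℝ) (t : ℝ) :
    envQuantity I (y + dirMap i j t) l = envQuantity I y l := by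
  unfold envQuantity
  congr 1
  refine Finset.sum_congr rfl fun a ha => ?_
  have : a ≠ i := fun h => hi (h ▸ ha)
  simp [dirMap_apply, this]

lemma env_dir_self {k d : ℕ} (I : Finset (Fin k)) (i : Fin k) (hi : i ∈ I) (j : Fin d)
    (y : Fin k → Fin d → ℝ) (t : ℝ) :
    envQuantity I (y + dirMap i j t) j
      = ((y i j + t) ^ 2)⁻¹ + ((∑ a ∈ I.erase i, ((y a j) ^ 2)⁻¹) - (I.card : ℝ)) := by
  unfold envQuantity
  rw [← Finset.add_sum_erase I _ hi, add_sub_assoc]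
  congr 1
  · simp [dirMap_apply]
  · congr 1
    refine Finset.sum_congr rfl fun a ha => ?_
    have : a ≠ i := Finset.ne_of_mem_erase ha
    simp [dirMap_apply, this]

lemma finite_line_aux (a c r : ℝ) : {t : ℝ | ((a + t) ^ 2)⁻¹ + c = r}.Finite := by
  refine Set.Finite.subset
    (Set.toFinite {Real.sqrt ((r - c)⁻¹) - a, -Real.sqrt ((r - c)⁻¹) - a}) ?_
  intro t ht
  have h1 : (a + t) ^ 2 = (r - c)⁻¹ := by
    rw [← inv_inv ((a + t) ^ 2)]
    congr 1
    have : ((a + t) ^ 2)⁻¹ + c = r := ht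
    linarith
  have h2 : (a + t) ^ 2 = (Real.sqrt ((r - c)⁻¹)) ^ 2 := by
    rw [Real.sq_sqrt (h1 ▸ sq_nonneg _), h1]
  rcases sq_eq_sq_iff_eq_or_eq_neg.mp h2 with h | h
  · left; linarith
  · right; simp only [Set.mem_singleton_iff]; linarith

open MeasureTheory in
lemma ae_env_ne {k d : ℕ} (I : Finset (Fin k)) (i : Fin k) (hi : i ∈ I) (j : Fin d)
    (F : (Fin k → Fin d → ℝ) → ℝ) (hF : Measurable F)
    (hinv : ∀ y t, F (y + dirMap i j t) = F y) :
    ∀ᵐ lam : Fin k → Fin d → ℝ, envQuantity I lam j ≠ F lam := by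
  have hs : MeasurableSet {lam : Fin k → Fin d → ℝ | envQuantity I lam j ≠ F lam} :=
    (measurableSet_eq_fun (measurable_envQuantity_aux I j) hF).compl
  refine (ae_ae_add_linearMap_mem_iff (dirMap i j) (volume : Measure ℝ) volume hs).1 ?_
  refine Filter.Eventually.of_forall fun y => ?_
  have hfin := finite_line_aux (y i j)
    ((∑ a ∈ I.erase i, ((y a j) ^ 2)⁻¹) - (I.card : ℝ)) (F y)
  filter_upwards [compl_mem_ae_iff.2 (hfin.measure_zero volume)] with t ht
  intro h
  rw [hinv, env_dir_self I i hi] at h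
  exact ht h

/-- With `A λ j := (∑ i ∈ I₁, (λ i j)⁻²) - |I₁|` and
`B λ j := (∑ i ∈ I₂, (λ i j)⁻²) - |I₂|`, the set of rescaling arrays `λ` (with all entries
nonzero) for which some `A λ j` vanishes, or some `B λ j` vanishes, or two diagonal ratios
coincide (`A λ j * B λ ℓ = A λ ℓ * B λ j` for some `j ≠ ℓ`), has Lebesgue measure zero. -/
theorem distinct_omega_ratios_measure_zero {k d : ℕ} (hk : 1 ≤ k) (hd : 2 ≤ d)
    (I₁ I₂ : Finset (Fin k)) (hI₁ : I₁.Nonempty) (hI₂ : I₂.Nonempty)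
    (hdisj : Disjoint I₁ I₂) :
    MeasureTheory.volume
      {lam : Fin k → Fin d → ℝ |
        (∀ i j, lam i j ≠ 0) ∧
        ((∃ j, envQuantity I₁ lam j = 0) ∨
         (∃ j, envQuantity I₂ lam j = 0) ∨
         (∃ j ℓ, j ≠ ℓ ∧
            envQuantity I₁ lam j * envQuantity I₂ lam ℓ
              = envQuantity I₁ lam ℓ * envQuantity I₂ lam j))} = 0 := by
  obtain ⟨i₁, hi₁⟩ := hI₁
  obtain ⟨i₂, hi₂⟩ := hI₂
  have hn : i₁ ∉ I₂ := Finset.disjoint_left.1 hdisj hi₁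
  have hA : ∀ᵐ lam : Fin k → Fin d → ℝ, ∀ j, envQuantity I₁ lam j ≠ 0 :=
    MeasureTheory.ae_all_iff.2 fun j =>
      ae_env_ne I₁ i₁ hi₁ j (fun _ => 0) measurable_const (fun _ _ => rfl)
  have hB : ∀ᵐ lam : Fin k → Fin d → ℝ, ∀ j, envQuantity I₂ lam j ≠ 0 :=
    MeasureTheory.ae_all_iff.2 fun j =>
      ae_env_ne I₂ i₂ hi₂ j (fun _ => 0) measurable_const (fun _ _ => rfl)
  have hC : ∀ᵐ lam : Fin k → Fin d → ℝ, ∀ j l, j ≠ l → envQuantity I₁ lam j ≠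
      envQuantity I₁ lam l * envQuantity I₂ lam j / envQuantity I₂ lam l := by
    refine MeasureTheory.ae_all_iff.2 fun j => MeasureTheory.ae_all_iff.2 fun l => ?_
    by_cases hjl : j = l
    · exact Filter.Eventually.of_forall fun _ h => absurd hjl h
    · filter_upwards [ae_env_ne I₁ i₁ hi₁ j
        (fun lam => envQuantity I₁ lam l * envQuantity I₂ lam j / envQuantity I₂ lam l)
        (((measurable_envQuantity_aux I₁ l).mul (measurable_envQuantity_aux I₂ j)).div
          (measurable_envQuantity_aux I₂ l))
        (fun y t => by
          simp only [env_dir_row I₂ i₁ hn, env_dir_col I₁ i₁ j l (Ne.symm hjl)])] with lam h _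
      exact h
  refine MeasureTheory.compl_mem_ae_iff.1 ?_
  filter_upwards [hA, hB, hC] with lam a b c
  rintro ⟨-, ⟨j, h⟩ | ⟨j, h⟩ | ⟨j, l, hjl, h⟩⟩
  · exact a j h
  · exact b j h
  · exact c j l hjl ((eq_div_iff (b l)).2 h)
end

section
/- Let E and F be finite-dimensional real inner product spaces (e.g. EuclideanSpace ℝ (Fin d)), let h : F → E and g : E → ℝ be twice continuously differentiable (ContDiff ℝ 2), and let x₀ : F be a point such that fderiv ℝ g (h x₀) = 0. Then for all u v : F, the second derivative of the composition satisfies iteratedFDeriv ℝ 2 (g ∘ h) x₀ ![u, v] = iteratedFDeriv ℝ 2 g (h x₀) ![fderiv ℝ h x₀ u, fderiv ℝ h x₀ v]. -/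
/-- Second-order chain rule at a critical point of the outer function: if
`h : F → E` and `g : E → ℝ` are `C²` and `fderiv ℝ g (h x₀) = 0`, then the second
derivative of `g ∘ h` at `x₀` is the pullback of the second derivative of `g` at `h x₀`
by the first derivative of `h`. -/
theorem second_deriv_comp_of_grad_zero
    {E F : Type*}
    [NormedAddCommGroup E] [InnerProductSpace ℝ E] [FiniteDimensional ℝ E]
    [NormedAddCommGroup F] [InnerProductSpace ℝ F] [FiniteDimensional ℝ F]
    (h : F → E) (g : E → ℝ) (hh : ContDiff ℝ 2 h) (hg : ContDiff ℝ 2 g)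
    (x₀ : F) (hgrad : fderiv ℝ g (h x₀) = 0) (u v : F) :
    iteratedFDeriv ℝ 2 (g ∘ h) x₀ ![u, v]
      = iteratedFDeriv ℝ 2 g (h x₀) ![fderiv ℝ h x₀ u, fderiv ℝ h x₀ v] := by
  have hh1 : Differentiable ℝ h := hh.differentiable (by norm_num)
  have hg1 : Differentiable ℝ g := hg.differentiable (by norm_num)
  have hh2 : Differentiable ℝ (fderiv ℝ h) :=
    (hh.fderiv_right (m := 1) (by norm_num)).differentiable (by norm_num)
  have hg2 : Differentiable ℝ (fderiv ℝ g) :=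
    (hg.fderiv_right (m := 1) (by norm_num)).differentiable (by norm_num)
  have key : fderiv ℝ (g ∘ h) = fun y => (fderiv ℝ g (h y)).comp (fderiv ℝ h y) := by
    funext y
    exact fderiv_comp y (hg1 (h y)) (hh1 y)
  have hc : HasFDerivAt (fun y => fderiv ℝ g (h y))
      ((fderiv ℝ (fderiv ℝ g) (h x₀)).comp (fderiv ℝ h x₀)) x₀ :=
    (hg2 (h x₀)).hasFDerivAt.comp x₀ (hh1 x₀).hasFDerivAt
  rw [iteratedFDeriv_two_apply, iteratedFDeriv_two_apply, key,
    (hc.clm_comp (hh2 x₀).hasFDerivAt).fderiv]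
  simp [hgrad]
end
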